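/- Let a and d be positive integers, neither divisible by 8. Then there exist z₁, z₂ ∈ ℤ⁸ such that Σᵢ (z₁)ᵢ² = a, Σᵢ (z₂)ᵢ² = d, Σᵢ (z₁)ᵢ(z₂)ᵢ = 0, the subgroup ℤz₁ + ℤz₂ is primitive in ℤ⁸, i.e. (ℚz₁ + ℚz₂) ∩ ℤ⁸ = ℤz₁ + ℤz₂, and there exists a ℤ-linear automorphism σ of ℤ⁸ preserving the standard dot product with σ(z₁) = −z₁ and σ(z₂) = z₂. -/

import Mathlib

/-- The standard dot product on `ℤ⁸`. -/
def dot8 (x y : Fin 8 → ℤ) : ℤ := ∑ i, x i * y i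


def Prim4 (a b c d : ℤ) : Prop :=
  ∀ p : ℕ, p.Prime → (p : ℤ) ∣ a → (p : ℤ) ∣ b → (p : ℤ) ∣ c → (p : ℤ) ∣ d → False

theorem dvd_back (l a b c d x y z w : ℤ)
    (h1 : l ∣ a * x - b * y - c * z - d * w) (h2 : l ∣ a * y + b * x + c * w - d * z)
    (h3 : l ∣ a * z - b * w + c * x + d * y) (h4 : l ∣ a * w + b * z - c * y + d * x) :
    let N := x ^ 2 + y ^ 2 + z ^ 2 + w ^ 2
    l ∣ N * a ∧ l ∣ N * b ∧ l ∣ N * c ∧ l ∣ N * d := by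
  intro N
  obtain ⟨r1, h1⟩ := h1
  obtain ⟨r2, h2⟩ := h2
  obtain ⟨r3, h3⟩ := h3
  obtain ⟨r4, h4⟩ := h4
  refine ⟨⟨r1 * x + r2 * y + r3 * z + r4 * w, ?_⟩, ⟨-r1 * y + r2 * x - r3 * w + r4 * z, ?_⟩,
    ⟨-r1 * z + r2 * w + r3 * x - r4 * y, ?_⟩, ⟨-r1 * w - r2 * z + r3 * y + r4 * x, ?_⟩⟩
  · linear_combination x * h1 + y * h2 + z * h3 + w * h4
  · linear_combination -y * h1 + x * h2 - w * h3 + z * h4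
  · linear_combination -z * h1 + w * h2 + x * h3 - y * h4
  · linear_combination -w * h1 - z * h2 + y * h3 + x * h4

theorem prim_back {l : ℕ} (hl : l.Prime) {a b c d N : ℤ} (hP : Prim4 a b c d)
    (h : (l : ℤ) ∣ N * a ∧ (l : ℤ) ∣ N * b ∧ (l : ℤ) ∣ N * c ∧ (l : ℤ) ∣ N * d) :
    (l : ℤ) ∣ N := by
  by_contra hN
  have hp := Nat.prime_iff_prime_int.1 hl
  exact hP l hl ((hp.dvd_or_dvd h.1).resolve_left hN) ((hp.dvd_or_dvd h.2.1).resolve_left hN)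
    ((hp.dvd_or_dvd h.2.2.1).resolve_left hN) ((hp.dvd_or_dvd h.2.2.2).resolve_left hN)

def PrimRep (n : ℤ) : Prop := ∃ a b c d : ℤ, a ^ 2 + b ^ 2 + c ^ 2 + d ^ 2 = n ∧ Prim4 a b c d

theorem prime_rep {p : ℕ} (hp : p.Prime) :
    ∃ x y z w : ℤ, x ^ 2 + y ^ 2 + z ^ 2 + w ^ 2 = p ∧ x ≠ 0 := by
  obtain ⟨a, b, c, d, h⟩ := hp.sum_four_squares
  have h' : (a : ℤ) ^ 2 + b ^ 2 + c ^ 2 + d ^ 2 = p := by exact_mod_cast h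
  have h0 : (p : ℤ) ≠ 0 := by exact_mod_cast hp.ne_zero
  by_cases ha : (a : ℤ) = 0
  · by_cases hb : (b : ℤ) = 0
    · by_cases hc : (c : ℤ) = 0
      · refine ⟨d, a, b, c, by linarith, fun hd => h0 ?_⟩
        rw [← h', ha, hb, hc, hd]; norm_num
      · exact ⟨c, a, b, d, by linarith, hc⟩
    · exact ⟨b, a, c, d, by linarith, hb⟩
  · exact ⟨a, b, c, d, h', ha⟩

theorem rep_mul {n : ℤ} {p : ℕ} (hp : p.Prime) (hp2 : p ≠ 2) (h : PrimRep n) : PrimRep (p * n) := by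
  obtain ⟨a, b, c, d, hn, hP⟩ := h
  obtain ⟨x, y, z, w, hx, hx0⟩ := prime_rep hp
  have hpi := Nat.prime_iff_prime_int.1 hp
  have key : ∀ y z w : ℤ, x ^ 2 + y ^ 2 + z ^ 2 + w ^ 2 = p → ¬ PrimRep (p * n) →
      (p : ℤ) ∣ a * x - b * y - c * z - d * w ∧ (p : ℤ) ∣ a * y + b * x + c * w - d * z ∧
      (p : ℤ) ∣ a * z - b * w + c * x + d * y ∧ (p : ℤ) ∣ a * w + b * z - c * y + d * x := by
    intro y z w hx hR
    by_contra hcon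
    refine hR ⟨_, _, _, _, (euler_four_squares a b c d x y z w).trans ?_, ?_⟩
    · rw [hn, hx, mul_comm]
    · intro l hl h1 h2 h3 h4
      have h5 := prim_back hl hP (dvd_back l a b c d x y z w h1 h2 h3 h4)
      rw [hx] at h5
      have h6 := (Nat.prime_dvd_prime_iff_eq hl hp).1 (by exact_mod_cast h5)
      subst h6
      exact hcon ⟨h1, h2, h3, h4⟩
  by_contra hR
  obtain ⟨h1, h2, h3, h4⟩ := key y z w hx hR
  obtain ⟨k1, k2, k3, k4⟩ := key (-y) (-z) (-w) (by linarith) hR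
  have h5 : (p : ℤ) ∣ 2 * x := by
    refine prim_back hp hP ⟨?_, ?_, ?_, ?_⟩
    · exact (dvd_add h1 k1).trans (dvd_of_eq (by ring))
    · exact (dvd_add h2 k2).trans (dvd_of_eq (by ring))
    · exact (dvd_add h3 k3).trans (dvd_of_eq (by ring))
    · exact (dvd_add h4 k4).trans (dvd_of_eq (by ring))
  have h6 : (p : ℤ) ∣ x := by
    refine (hpi.dvd_or_dvd h5).resolve_left fun h => hp2 ?_
    exact (Nat.prime_dvd_prime_iff_eq hp Nat.prime_two).1 (by exact_mod_cast h)
  obtain ⟨k, rfl⟩ := h6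
  have hk : 1 ≤ k ^ 2 := by
    have : k ≠ 0 := by rintro rfl; simp at hx0
    have := sq_pos_of_ne_zero this
    omega
  have hp' : (2 : ℤ) ≤ p := by exact_mod_cast hp.two_le
  nlinarith [sq_nonneg y, sq_nonneg z, sq_nonneg w, mul_le_mul_of_nonneg_left hk (sq_nonneg (p : ℤ))]

theorem rep_odd (n : ℕ) (h : n % 2 = 1) : PrimRep n := by
  induction n using induction_on_primes with
  | zero => simp at h
  | one => exact ⟨1, 0, 0, 0, by norm_num, fun p hp h _ _ _ => hp.one_lt.ne' (by
      have : p ∣ 1 := by exact_mod_cast h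
      simpa using this)⟩
  | prime_mul p a hp ih =>
    have hpa := Nat.odd_mul.1 (Nat.odd_iff.2 h)
    rw [Nat.cast_mul]
    refine rep_mul hp ?_ (ih (Nat.odd_iff.1 hpa.2))
    rintro rfl
    exact absurd hpa.1 (by decide)

theorem rep_two {n : ℤ} (hodd : n % 2 = 1) (h : PrimRep n) : PrimRep (2 * n) := by
  obtain ⟨a, b, c, d, hn, hP⟩ := h
  refine ⟨_, _, _, _, (euler_four_squares a b c d 1 1 0 0).trans (by rw [hn]; ring), ?_⟩
  intro l hl h1 h2 h3 h4
  have h5 := prim_back hl hP (dvd_back l a b c d _ _ _ _ h1 h2 h3 h4)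
  norm_num at h5
  have h6 := (Nat.prime_dvd_prime_iff_eq hl Nat.prime_two).1 (by exact_mod_cast h5)
  subst h6
  obtain ⟨s, h1⟩ := h1
  obtain ⟨t, h3⟩ := h3
  push_cast at h1 h3
  have e1 : a = 2 * s + b := by linarith
  have e3 : c = 2 * t - d := by linarith
  have : n = 2 * (2 * s ^ 2 + 2 * s * b + b ^ 2 + 2 * t ^ 2 - 2 * t * d + d ^ 2) := by
    rw [← hn, e1, e3]; ring
  omega

theorem rep_four {n : ℤ} (hodd : n % 2 = 1) (h : PrimRep n) : PrimRep (4 * n) := by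
  obtain ⟨a, b, c, d, hn, hP⟩ := h
  refine ⟨_, _, _, _, (euler_four_squares a b c d 1 1 1 1).trans (by rw [hn]; ring), ?_⟩
  intro l hl h1 h2 h3 h4
  have h5 := prim_back hl hP (dvd_back l a b c d _ _ _ _ h1 h2 h3 h4)
  norm_num at h5
  have h7 : l ∣ 2 ^ 2 := by exact_mod_cast h5
  have h6 := (Nat.prime_dvd_prime_iff_eq hl Nat.prime_two).1 (hl.dvd_of_dvd_pow h7)
  subst h6
  obtain ⟨s, h1⟩ := h1
  push_cast at h1
  have e1 : a = 2 * s + b + c + d := by linarith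
  have : n = 2 * (2 * s ^ 2 + 2 * s * (b + c + d) + b ^ 2 + c ^ 2 + d ^ 2
      + b * c + b * d + c * d) := by
    rw [← hn, e1]; ring
  omega

theorem rep_all (n : ℤ) (h0 : 0 < n) (h8 : ¬ 8 ∣ n) : PrimRep n := by
  have ho : ∀ m : ℤ, 0 < m → m % 2 = 1 → PrimRep m := by
    intro m hm h
    lift m to ℕ using hm.le
    exact rep_odd m (by omega)
  rcases (by omega : n % 2 = 1 ∨ (n = 2 * (n / 2) ∧ n / 2 % 2 = 1) ∨
    (n = 4 * (n / 4) ∧ n / 4 % 2 = 1)) with h | ⟨h, h'⟩ | ⟨h, h'⟩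
  · exact ho n h0 h
  · rw [h]; exact rep_two h' (ho _ (by omega) h')
  · rw [h]; exact rep_four h' (ho _ (by omega) h')

theorem rep_bezout (n : ℤ) (h : PrimRep n) : ∃ a b c d : ℤ, a ^ 2 + b ^ 2 + c ^ 2 + d ^ 2 = n ∧
    ∃ x y z w : ℤ, x * a + y * b + z * c + w * d = 1 := by
  obtain ⟨a, b, c, d, hn, hP⟩ := h
  refine ⟨a, b, c, d, hn, ?_⟩
  have hg : Int.gcd (Int.gcd a b) (Int.gcd c d) = 1 := by
    by_contra hne
    obtain ⟨p, hp, hd⟩ := Nat.exists_prime_and_dvd hne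
    have hd' : (p : ℤ) ∣ Int.gcd (Int.gcd a b) (Int.gcd c d) := by exact_mod_cast hd
    have h1 := hd'.trans (Int.gcd_dvd_left _ _)
    have h2 := hd'.trans (Int.gcd_dvd_right _ _)
    exact hP p hp (h1.trans (Int.gcd_dvd_left _ _)) (h1.trans (Int.gcd_dvd_right _ _))
      (h2.trans (Int.gcd_dvd_left _ _)) (h2.trans (Int.gcd_dvd_right _ _))
  have e := Int.gcd_eq_gcd_ab (Int.gcd a b) (Int.gcd c d)
  rw [hg] at e
  generalize Int.gcdA (Int.gcd a b) (Int.gcd c d) = s at e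
  generalize Int.gcdB (Int.gcd a b) (Int.gcd c d) = t at e
  rw [Int.gcd_eq_gcd_ab a b, Int.gcd_eq_gcd_ab c d] at e
  push_cast at e
  exact ⟨a.gcdA b * s, a.gcdB b * s, c.gcdA d * t, c.gcdB d * t, by linarith⟩

/-- For positive integers `a`, `d` not divisible by `8`, there exist orthogonal
vectors `z₁`, `z₂` in `ℤ⁸` of square `a`, `d`, spanning a primitive subgroup, such
that the reflection along `z₁` extends to an isometry of `ℤ⁸`. -/
theorem stmt4 (a d : ℤ) (ha : 0 < a) (hd : 0 < d)
    (h8a : ¬ (8 ∣ a)) (h8d : ¬ (8 ∣ d)) :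
    ∃ z₁ z₂ : Fin 8 → ℤ,
      dot8 z₁ z₁ = a ∧ dot8 z₂ z₂ = d ∧ dot8 z₁ z₂ = 0 ∧
      (∀ x : Fin 8 → ℤ,
        (∃ p q : ℚ, (fun i => (x i : ℚ))
          = p • (fun i => (z₁ i : ℚ)) + q • (fun i => (z₂ i : ℚ))) →
        ∃ m n : ℤ, x = m • z₁ + n • z₂) ∧
      ∃ σ : (Fin 8 → ℤ) ≃ₗ[ℤ] (Fin 8 → ℤ),
        (∀ x y, dot8 (σ x) (σ y) = dot8 x y) ∧ σ z₁ = -z₁ ∧ σ z₂ = z₂ := by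
  obtain ⟨a₁, a₂, a₃, a₄, hA, x, y, z, w, hu⟩ := rep_bezout a (rep_all a ha h8a)
  obtain ⟨d₁, d₂, d₃, d₄, hD, x', y', z', w', hv⟩ := rep_bezout d (rep_all d hd h8d)
  refine ⟨![a₁, a₂, a₃, a₄, 0, 0, 0, 0], ![0, 0, 0, 0, d₁, d₂, d₃, d₄], ?_, ?_, ?_, ?_, ?_⟩
  · simp [dot8, Fin.sum_univ_eight]; linarith
  · simp [dot8, Fin.sum_univ_eight]; linarith
  · simp [dot8, Fin.sum_univ_eight]
  · rintro f ⟨p, q, h⟩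
    have e (i) := congrFun h i
    have e0 := e 0
    have e1 := e 1
    have e2 := e 2
    have e3 := e 3
    have e4 := e 4
    have e5 := e 5
    have e6 := e 6
    have e7 := e 7
    simp at e0 e1 e2 e3 e4 e5 e6 e7
    have hu' : (x * a₁ + y * a₂ + z * a₃ + w * a₄ : ℚ) = 1 := by exact_mod_cast hu
    have hv' : (x' * d₁ + y' * d₂ + z' * d₃ + w' * d₄ : ℚ) = 1 := by exact_mod_cast hv
    have hp : p = ((x * f 0 + y * f 1 + z * f 2 + w * f 3 : ℤ) : ℚ) := by
      push_cast; rw [e0, e1, e2, e3]; linear_combination -p * hu'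
    have hq : q = ((x' * f 4 + y' * f 5 + z' * f 6 + w' * f 7 : ℤ) : ℚ) := by
      push_cast; rw [e4, e5, e6, e7]; linear_combination -q * hv'
    generalize x * f 0 + y * f 1 + z * f 2 + w * f 3 = m at hp
    generalize x' * f 4 + y' * f 5 + z' * f 6 + w' * f 7 = n at hq
    subst hp hq
    refine ⟨m, n, ?_⟩
    norm_cast at e0 e1 e2 e3 e4 e5 e6 e7
    funext i
    fin_cases i <;> simp [*]
  · let s : Fin 8 → ℤ := ![-1, -1, -1, -1, 1, 1, 1, 1]
    have hs : ∀ i, s i * s i = 1 := by decide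
    let σ : (Fin 8 → ℤ) →ₗ[ℤ] (Fin 8 → ℤ) :=
      { toFun := fun f i => s i * f i
        map_add' := fun f g => by funext i; simp [mul_add]
        map_smul' := fun c f => by funext i; simp [mul_left_comm] }
    have hσ : ∀ f i, σ f i = s i * f i := fun _ _ => rfl
    have hσσ : ∀ f, σ (σ f) = f := fun f => by
      funext i; rw [hσ, hσ, ← mul_assoc, hs, one_mul]
    have hE : ∀ f i, (LinearEquiv.ofInvolutive σ hσσ) f i = s i * f i := fun _ _ => rfl
    refine ⟨LinearEquiv.ofInvolutive σ hσσ, ?_, ?_, ?_⟩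
    · intro f g
      simp only [dot8, hE]
      refine Finset.sum_congr rfl fun i _ => ?_
      linear_combination f i * g i * hs i
    · funext i
      simp only [hE]
      fin_cases i <;> simp [s]
    · funext i
      simp only [hE]
      fin_cases i <;> simp [s]
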